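/- Let m ≥ 1 be an integer, α > 0, T > 0, and let λ : [0,T] → [0,∞) be continuous and nonnegative. Let v : ℝ × [0,T] → (0,∞) be a smooth function, 2mπ-periodic in θ, satisfying v_t = α v^p (v_θθ + v − λ(t)) with p = 1 + 1/α. Define Ψ = v² + (v_θ)². Then for every t ∈ [0,T], max over ℝ × [0,t] of Ψ ≤ max{ max over ℝ × [0,t] of v², max over ℝ × {0} of Ψ }. -/

import Mathlib

open Real MeasureTheory Filter

/-- The gradient quantity `Ψ = v² + (v_θ)²` of the curvature estimate. -/
noncomputable def Psi (v : ℝ → ℝ → ℝ) (θ t : ℝ) : ℝ :=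
  (v θ t) ^ 2 + (deriv (fun x => v x t) θ) ^ 2

/-- The closed space-time strip. -/
def stripT (T : ℝ) : Set (ℝ × ℝ) := Set.univ ×ˢ Set.Icc (0:ℝ) T

/-- Space derivative on the strip. -/
noncomputable def dOne (T : ℝ) (G : ℝ × ℝ → ℝ) (p : ℝ × ℝ) : ℝ :=
  fderivWithin ℝ G (stripT T) p (1, 0)

/-- Time derivative on the strip. -/
noncomputable def dTwo (T : ℝ) (G : ℝ × ℝ → ℝ) (p : ℝ × ℝ) : ℝ :=
  fderivWithin ℝ G (stripT T) p (0, 1)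

lemma strip_unique {T : ℝ} (hT : 0 < T) : UniqueDiffOn ℝ (stripT T) :=
  uniqueDiffOn_univ.prod (uniqueDiffOn_Icc hT)

lemma dOne_smooth {T : ℝ} (hT : 0 < T) {G : ℝ × ℝ → ℝ}
    (hG : ContDiffOn ℝ (⊤ : ℕ∞) G (stripT T)) : ContDiffOn ℝ (⊤ : ℕ∞) (dOne T G) (stripT T) :=
  (hG.fderivWithin (strip_unique hT) (by simp)).clm_apply contDiffOn_const

lemma dTwo_smooth {T : ℝ} (hT : 0 < T) {G : ℝ × ℝ → ℝ}
    (hG : ContDiffOn ℝ (⊤ : ℕ∞) G (stripT T)) : ContDiffOn ℝ (⊤ : ℕ∞) (dTwo T G) (stripT T) :=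
  (hG.fderivWithin (strip_unique hT) (by simp)).clm_apply contDiffOn_const

lemma hasDeriv_dOne {T : ℝ} {G : ℝ × ℝ → ℝ}
    (hG : ContDiffOn ℝ (⊤ : ℕ∞) G (stripT T)) (x s : ℝ) (hs : s ∈ Set.Icc (0:ℝ) T) :
    HasDerivAt (fun y => G (y, s)) (dOne T G (x, s)) x := by
  have h := (hG.differentiableOn (by simp) (x, s) ⟨trivial, hs⟩).hasFDerivWithinAt
  have hf : HasDerivWithinAt (fun y : ℝ => (y, s)) (1, 0) Set.univ x :=
    ((hasDerivAt_id x).prodMk (hasDerivAt_const x s)).hasDerivWithinAt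
  have := HasFDerivWithinAt.comp_hasDerivWithinAt x h hf
    (fun y _ => (⟨trivial, hs⟩ : (y, s) ∈ stripT T))
  exact hasDerivWithinAt_univ.1 this

lemma hasDeriv_dTwo {T : ℝ} {G : ℝ × ℝ → ℝ}
    (hG : ContDiffOn ℝ (⊤ : ℕ∞) G (stripT T)) (x s : ℝ) (hs : s ∈ Set.Icc (0:ℝ) T) :
    HasDerivWithinAt (fun r => G (x, r)) (dTwo T G (x, s)) (Set.Icc 0 T) s := by
  have h := (hG.differentiableOn (by simp) (x, s) ⟨trivial, hs⟩).hasFDerivWithinAt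
  have hf : HasDerivWithinAt (fun r : ℝ => (x, r)) (0, 1) (Set.Icc 0 T) s :=
    ((hasDerivAt_const s x).prodMk (hasDerivAt_id s)).hasDerivWithinAt
  exact HasFDerivWithinAt.comp_hasDerivWithinAt s h hf
    (fun r hr => (⟨trivial, hr⟩ : (x, r) ∈ stripT T))

lemma dOne_dTwo_comm {T : ℝ} (hT : 0 < T) {G : ℝ × ℝ → ℝ}
    (hG : ContDiffOn ℝ (⊤ : ℕ∞) G (stripT T)) (p : ℝ × ℝ) (hp : p ∈ stripT T) :
    dTwo T (dOne T G) p = dOne T (dTwo T G) p := by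
  have hU := strip_unique hT
  have hd : DifferentiableWithinAt ℝ (fderivWithin ℝ G (stripT T)) (stripT T) p :=
    (hG.fderivWithin (m := (⊤ : ℕ∞)) hU (by simp)).differentiableOn (by simp) p hp
  have key : ∀ a b : ℝ × ℝ, fderivWithin ℝ (fun q => fderivWithin ℝ G (stripT T) q a) (stripT T) p b
      = fderivWithin ℝ (fderivWithin ℝ G (stripT T)) (stripT T) p b a := by
    intro a b
    rw [fderivWithin_clm_apply (hU p hp) hd (differentiableWithinAt_const a)]
    simp
  have hsym : IsSymmSndFDerivWithinAt ℝ G (stripT T) p := by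
    refine ContDiffWithinAt.isSymmSndFDerivWithinAt (hG p hp) ?_ hU ?_ hp
    · simp
      exact WithTop.coe_le_coe.2 (le_top : (2 : ℕ∞) ≤ ⊤)
    · have : closure (interior (stripT T)) = stripT T := by
        rw [stripT, interior_prod_eq, closure_prod_eq]
        simp [closure_Ioo hT.ne]
      rw [this]; exact hp
  change fderivWithin ℝ (fun q => fderivWithin ℝ G (stripT T) q (1,0)) (stripT T) p (0,1)
    = fderivWithin ℝ (fun q => fderivWithin ℝ G (stripT T) q (0,1)) (stripT T) p (1,0)
  rw [key, key, hsym.eq]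

lemma left_deriv_nonneg {f : ℝ → ℝ} {c s0 T : ℝ} (h0 : 0 < s0) (hsT : s0 ≤ T)
    (hd : HasDerivWithinAt f c (Set.Icc 0 T) s0)
    (hm : ∀ s ∈ Set.Icc 0 s0, f s ≤ f s0) : 0 ≤ c := by
  have h1 : HasDerivWithinAt f c (Set.Ioo 0 s0) s0 :=
    hd.mono (fun x hx => ⟨hx.1.le, hx.2.le.trans hsT⟩)
  rw [hasDerivWithinAt_iff_tendsto_slope' (by simp)] at h1
  have : (nhdsWithin s0 (Set.Ioo 0 s0)).NeBot := right_nhdsWithin_Ioo_neBot h0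
  refine ge_of_tendsto h1 ?_
  filter_upwards [self_mem_nhdsWithin] with s hs
  rw [slope_def_field]
  exact div_nonneg_of_nonpos (by linarith [hm s ⟨hs.1.le, hs.2.le⟩]) (by linarith [hs.2])

lemma second_deriv_nonpos {f g : ℝ → ℝ} {c x : ℝ} (hf : ∀ y, HasDerivAt f (g y) y)
    (hg : HasDerivAt g c x) (hm : ∀ y, f y ≤ f x) : c ≤ 0 := by
  by_contra hc
  push Not at hc
  have hfg : deriv f = g := funext fun y => (hf y).deriv
  have hmax : IsLocalMax f x := Eventually.of_forall hm
  have hmin : IsLocalMin f x := by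
    apply isLocalMin_of_deriv_deriv_pos
    · rw [hfg, hg.deriv]; exact hc
    · exact hmax.deriv_eq_zero
    · exact (hf x).continuousAt
  have he : f =ᶠ[nhds x] fun _ => f x := by
    filter_upwards [hmin] with y hy
    exact le_antisymm (hm y) hy
  have h2 : deriv (deriv f) x = 0 := by
    rw [he.deriv.deriv_eq]; simp
  rw [hfg, hg.deriv] at h2
  exact hc.ne' h2

/-- Gradient estimate: along `v_t = α v^p (v_θθ + v − λ(t))` with `p = 1 + 1/α` and
`λ ≥ 0`, the maximum of `Ψ = v² + (v_θ)²` over `ℝ × [0,t]` is bounded by the maximum of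
`v²` over `ℝ × [0,t]` or the maximum of `Ψ` at the initial time. -/
theorem gradient_estimate_Psi
    (m : ℕ) (hm : 1 ≤ m) (α T : ℝ) (hα : 0 < α) (hT : 0 < T)
    (lam : ℝ → ℝ) (hlamc : ContinuousOn lam (Set.Icc 0 T))
    (hlam : ∀ t ∈ Set.Icc (0:ℝ) T, 0 ≤ lam t)
    (v : ℝ → ℝ → ℝ)
    (hpos : ∀ θ, ∀ t ∈ Set.Icc (0:ℝ) T, 0 < v θ t)
    (hsmooth : ContDiffOn ℝ (⊤ : ℕ∞) (Function.uncurry v) (Set.univ ×ˢ Set.Icc (0:ℝ) T))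
    (hper : ∀ θ, ∀ t ∈ Set.Icc (0:ℝ) T, v (θ + 2 * m * π) t = v θ t)
    (hflow : ∀ θ, ∀ t ∈ Set.Icc (0:ℝ) T,
      derivWithin (fun s => v θ s) (Set.Icc 0 T) t
        = α * v θ t ^ (1 + 1/α) *
          (iteratedDeriv 2 (fun x => v x t) θ + v θ t - lam t)) :
    ∀ t ∈ Set.Icc (0:ℝ) T, ∀ θ, ∀ s ∈ Set.Icc (0:ℝ) t,
      Psi v θ s ≤
        max (⨆ θ' : ℝ, ⨆ s' : Set.Icc (0:ℝ) t, (v θ' (s' : ℝ)) ^ 2)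
            (⨆ θ' : ℝ, Psi v θ' 0) := by
  intro t ht θ s hs
  have hG : ContDiffOn ℝ (⊤ : ℕ∞) (Function.uncurry v) (stripT T) := hsmooth
  set F := Function.uncurry v with hF
  set F1 := dOne T F with hF1
  set F2 := dOne T F1 with hF2
  set F3 := dOne T F2 with hF3
  set Ft := dTwo T F with hFt
  have s1 : ContDiffOn ℝ (⊤ : ℕ∞) F1 (stripT T) := dOne_smooth hT hG
  have s2 : ContDiffOn ℝ (⊤ : ℕ∞) F2 (stripT T) := dOne_smooth hT s1
  have st : ContDiffOn ℝ (⊤ : ℕ∞) Ft (stripT T) := dTwo_smooth hT hG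
  have d1 := hasDeriv_dOne hG
  have d2 := hasDeriv_dOne s1
  have d3 := hasDeriv_dOne s2
  have dv1 : ∀ s ∈ Set.Icc (0:ℝ) T, deriv (fun x => v x s) = fun x => F1 (x, s) :=
    fun s hs => funext fun x => (d1 x s hs).deriv
  have hPsi : ∀ x, ∀ s ∈ Set.Icc (0:ℝ) T, Psi v x s = F (x, s) ^ 2 + F1 (x, s) ^ 2 := by
    intro x s hs
    rw [Psi, dv1 s hs]; rfl
  have hft : ∀ x, ∀ s ∈ Set.Icc (0:ℝ) T, Ft (x, s) =
      α * F (x, s) ^ (1 + 1/α) * (F2 (x, s) + F (x, s) - lam s) := by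
    intro x s hs
    have h := hflow x s hs
    rw [iteratedDeriv_succ, iteratedDeriv_one, dv1 s hs, (d2 x s hs).deriv] at h
    exact ((hasDeriv_dTwo hG x s hs).derivWithin (uniqueDiffOn_Icc hT s hs)).symm.trans h
  have hF0 : ∀ x, ∀ s ∈ Set.Icc (0:ℝ) T, 0 < F (x, s) := hpos
  -- time derivative of F1
  have hF1t : ∀ x, ∀ s ∈ Set.Icc (0:ℝ) T, dTwo T F1 (x, s) =
      α * (F1 (x, s) * (1 + 1/α) * F (x, s) ^ (1 + 1/α - 1)) * (F2 (x, s) + F (x, s) - lam s)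
        + α * F (x, s) ^ (1 + 1/α) * (F3 (x, s) + F1 (x, s)) := by
    intro x s hs
    rw [dOne_dTwo_comm hT hG (x, s) ⟨trivial, hs⟩]
    have e1 := hasDeriv_dOne st x s hs
    have e2 : HasDerivAt (fun y => α * F (y, s) ^ (1 + 1/α) * (F2 (y, s) + F (y, s) - lam s))
      (α * (F1 (x, s) * (1 + 1/α) * F (x, s) ^ (1 + 1/α - 1)) * (F2 (x, s) + F (x, s) - lam s)
        + α * F (x, s) ^ (1 + 1/α) * (F3 (x, s) + F1 (x, s))) x :=
      (((d1 x s hs).rpow_const (Or.inl (hF0 x s hs).ne')).const_mul α).mul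
        (((d3 x s hs).add (d1 x s hs)).sub_const _)
    have : (fun y => Ft (y, s)) =
        fun y => α * F (y, s) ^ (1 + 1/α) * (F2 (y, s) + F (y, s) - lam s) :=
      funext fun y => hft y s hs
    rw [this] at e1
    exact e1.unique e2
  -- the pointwise maximum principle
  have core : ∀ ε > 0, ∀ x0, ∀ s0 ∈ Set.Icc (0:ℝ) T, 0 < s0 →
      (∀ x, ∀ s ∈ Set.Icc (0:ℝ) s0, F (x, s) ^ 2 + F1 (x, s) ^ 2 - ε * s ≤
        F (x0, s0) ^ 2 + F1 (x0, s0) ^ 2 - ε * s0) → F1 (x0, s0) = 0 := by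
    intro ε hε x0 s0 hs0 hs0p hmax
    by_contra hne
    have dP : ∀ y, HasDerivAt (fun y => F (y, s0) ^ 2 + F1 (y, s0) ^ 2)
        (2 * F1 (y, s0) * (F (y, s0) + F2 (y, s0))) y := by
      intro y
      have := ((d1 y s0 hs0).pow 2).add ((d2 y s0 hs0).pow 2)
      refine this.congr_deriv ?_
      simp only [← hF1, ← hF2]
      push_cast
      ring
    have ddP : HasDerivAt (fun y => 2 * F1 (y, s0) * (F (y, s0) + F2 (y, s0)))
        (2 * F2 (x0, s0) * (F (x0, s0) + F2 (x0, s0))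
          + 2 * F1 (x0, s0) * (F1 (x0, s0) + F3 (x0, s0))) x0 :=
      ((d2 x0 s0 hs0).const_mul 2).mul ((d1 x0 s0 hs0).add (d3 x0 s0 hs0))
    have hmx : ∀ y, F (y, s0) ^ 2 + F1 (y, s0) ^ 2 ≤ F (x0, s0) ^ 2 + F1 (x0, s0) ^ 2 :=
      fun y => by linarith [hmax y s0 ⟨hs0p.le, le_rfl⟩]
    have hz : 2 * F1 (x0, s0) * (F (x0, s0) + F2 (x0, s0)) = 0 :=
      IsLocalMax.hasDerivAt_eq_zero (Eventually.of_forall hmx) (dP x0)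
    have hz' : F (x0, s0) + F2 (x0, s0) = 0 := by
      rcases mul_eq_zero.1 hz with h | h
      · exact absurd (by linarith) hne
      · exact h
    have hsec := second_deriv_nonpos dP ddP hmx
    have hti := ((((hasDeriv_dTwo hG x0 s0 hs0).pow 2).add
      ((hasDeriv_dTwo s1 x0 s0 hs0).pow 2)).sub
        (((hasDerivAt_id s0).const_mul ε).hasDerivWithinAt))
    have hc := left_deriv_nonneg hs0p hs0.2 hti (fun s hs => hmax x0 s hs)
    rw [hF1t x0 s0 hs0, ← hFt, hft x0 s0 hs0] at hc
    have hl := hlam s0 hs0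
    have hFp := hF0 x0 s0 hs0
    have hA : 0 < F (x0, s0) ^ (1 + 1/α) := Real.rpow_pos_of_pos hFp _
    have hB : 0 < F (x0, s0) ^ (1 + 1/α - 1) := Real.rpow_pos_of_pos hFp _
    have hq : 0 < 1 + 1/α := by positivity
    generalize F (x0, s0) ^ (1 + 1/α) = A at *
    generalize F (x0, s0) ^ (1 + 1/α - 1) = B at *
    generalize 1 + 1/α = q at *
    generalize F (x0, s0) = a at *
    generalize F1 (x0, s0) = b at *
    generalize F2 (x0, s0) = c at *
    generalize F3 (x0, s0) = d at *
    generalize lam s0 = l at *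
    have hc2 : c = -a := by linarith
    subst hc2
    have t1 : 0 ≤ α * A * l * a := by positivity
    have t2 : 0 ≤ α * q * B * l * b ^ 2 := by positivity
    have t3 : 0 ≤ α * A * (-(b * (b + d))) := by
      apply mul_nonneg (by positivity); linarith
    simp only [Nat.cast_ofNat] at hc
    norm_num at hc
    nlinarith
  -- periodicity
  have hL : 0 < 2 * (m:ℝ) * π := by
    have : (0:ℝ) < m := by exact_mod_cast hm
    positivity
  set P : ℝ × ℝ → ℝ := fun p => F p ^ 2 + F1 p ^ 2 with hP
  have hPper : ∀ s ∈ Set.Icc (0:ℝ) T, Function.Periodic (fun x => P (x, s)) (2 * m * π) := by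
    intro s hs x
    have h1 : (fun y => F (y + 2 * m * π, s)) = fun y => F (y, s) :=
      funext fun y => hper y s hs
    have h2 : F1 (x + 2 * m * π, s) = F1 (x, s) := by
      have a1 := (d1 (x + 2 * m * π) s hs).comp_add_const x (2 * m * π)
      have a2 := d1 x s hs
      rw [h1] at a1
      exact a1.unique a2
    have h3 : F (x + 2 * m * π, s) = F (x, s) := hper x s hs
    simp only [hP, h2, h3]
  have hPc : ContinuousOn P (stripT T) := (hG.continuousOn.pow 2).add (s1.continuousOn.pow 2)
  have hK : IsCompact (Set.Icc (0:ℝ) (2 * m * π) ×ˢ Set.Icc (0:ℝ) t) :=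
    isCompact_Icc.prod isCompact_Icc
  have hKs : (Set.Icc (0:ℝ) (2 * m * π) ×ˢ Set.Icc (0:ℝ) t) ⊆ stripT T :=
    fun p hp => ⟨trivial, hp.2.1, hp.2.2.trans ht.2⟩
  have exmax : ∀ ε : ℝ, ∃ x0, ∃ s0 ∈ Set.Icc (0:ℝ) t, ∀ x, ∀ s ∈ Set.Icc (0:ℝ) t,
      P (x, s) - ε * s ≤ P (x0, s0) - ε * s0 := by
    intro ε
    obtain ⟨⟨x0, s0⟩, h0, hmax⟩ := hK.exists_isMaxOn
      ⟨(0, 0), ⟨le_rfl, hL.le⟩, ⟨le_rfl, ht.1⟩⟩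
      (f := fun p => P p - ε * p.2)
      ((hPc.mono hKs).sub (by fun_prop))
    refine ⟨x0, s0, h0.2, fun x s hs => ?_⟩
    obtain ⟨y, hy, hxy⟩ := (hPper s ⟨hs.1, hs.2.trans ht.2⟩).exists_mem_Ico₀ hL x
    have := hmax (a := (y, s)) ⟨⟨hy.1, hy.2.le⟩, hs⟩
    change P (x, s) = P (y, s) at hxy
    rw [hxy]
    exact this
  obtain ⟨xb, sb, _, hb⟩ := exmax 0
  have hB : ∀ x, ∀ s ∈ Set.Icc (0:ℝ) t, P (x, s) ≤ P (xb, sb) := fun x s hs => by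
    simpa using hb x s hs
  have hvB : ∀ x, ∀ s ∈ Set.Icc (0:ℝ) t, v x s ^ 2 ≤ P (xb, sb) := fun x s hs => by
    refine le_trans ?_ (hB x s hs)
    change v x s ^ 2 ≤ v x s ^ 2 + F1 (x, s) ^ 2
    nlinarith [sq_nonneg (F1 (x, s))]
  haveI : Nonempty (Set.Icc (0:ℝ) t) := ⟨⟨0, le_rfl, ht.1⟩⟩
  have sup1 : ∀ x, ∀ s ∈ Set.Icc (0:ℝ) t, v x s ^ 2 ≤
      ⨆ θ' : ℝ, ⨆ s' : Set.Icc (0:ℝ) t, (v θ' (s' : ℝ)) ^ 2 := by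
    intro x s hs
    have i1 : BddAbove (Set.range fun s' : Set.Icc (0:ℝ) t => (v x (s' : ℝ)) ^ 2) :=
      ⟨P (xb, sb), by rintro _ ⟨s', rfl⟩; exact hvB x s' s'.2⟩
    have i2 : BddAbove (Set.range fun θ' : ℝ =>
        ⨆ s' : Set.Icc (0:ℝ) t, (v θ' (s' : ℝ)) ^ 2) :=
      ⟨P (xb, sb), by rintro _ ⟨y, rfl⟩; exact ciSup_le fun s' => hvB y s' s'.2⟩
    exact (le_ciSup i1 ⟨s, hs⟩).trans (le_ciSup i2 x)
  have sup2 : ∀ x, P (x, 0) ≤ ⨆ θ' : ℝ, Psi v θ' 0 := by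
    intro x
    have i1 : BddAbove (Set.range fun θ' : ℝ => Psi v θ' 0) := by
      refine ⟨P (xb, sb), ?_⟩
      rintro _ ⟨y, rfl⟩
      change Psi v y 0 ≤ _
      rw [hPsi y 0 ⟨le_rfl, hT.le⟩]
      exact hB y 0 ⟨le_rfl, ht.1⟩
    have := le_ciSup i1 x
    rw [hPsi x 0 ⟨le_rfl, hT.le⟩] at this
    exact this
  rw [hPsi θ s ⟨hs.1, hs.2.trans ht.2⟩]
  change P (θ, s) ≤ _
  set M := max (⨆ θ' : ℝ, ⨆ s' : Set.Icc (0:ℝ) t, (v θ' (s' : ℝ)) ^ 2)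
            (⨆ θ' : ℝ, Psi v θ' 0) with hM
  have main : ∀ ε > 0, P (θ, s) ≤ M + ε * s := by
    intro ε hε
    obtain ⟨x0, s0, hs0, hmax⟩ := exmax ε
    have h1 := hmax θ s hs
    have h2 : P (x0, s0) ≤ M := by
      rcases hs0.1.eq_or_lt with h | h
      · rw [← h]; exact (sup2 x0).trans (le_max_right _ _)
      · have hz := core ε hε x0 s0 ⟨hs0.1, hs0.2.trans ht.2⟩ h
          (fun x s hs => hmax x s ⟨hs.1, hs.2.trans hs0.2⟩)
        have : P (x0, s0) = v x0 s0 ^ 2 := by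
          simp only [hP, hz]
          simp [hF, Function.uncurry]
        rw [this]
        exact (sup1 x0 s0 hs0).trans (le_max_left _ _)
    have : 0 ≤ ε * s0 := mul_nonneg hε.le hs0.1
    linarith
  refine le_of_forall_pos_le_add fun δ hδ => ?_
  have h := main (δ / (s + 1)) (div_pos hδ (by linarith [hs.1]))
  have : δ / (s + 1) * s ≤ δ := by
    rw [div_mul_eq_mul_div, div_le_iff₀ (by linarith [hs.1])]
    nlinarith
  linarith
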